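/- arXiv:1406.2192 — 5 statements merged into one kernel-verified Lean document; each statement's English description precedes it below -/
import Mathlib

section
/- For i = 1,…,N let Hⁱ ∈ ℝ^{nᵢ×nᵢ}, Āⁱ ∈ ℝ^{pᵢ×nᵢ}, rⁱ, r_cⁱ ∈ ℝ^{nᵢ}, r_pⁱ ∈ ℝ^{pᵢ}, E_{Jᵢ} ∈ ℝ^{nᵢ×n}, v_cⁱ ∈ ℝ^{nᵢ}, ρ > 0, and iterates Δx ∈ ℝⁿ, Δv̄ⁱ, Δv̄_cⁱ. Suppose Δwⁱ⁺ satisfies (Hⁱ + ρI + ρ(Āⁱ)ᵀĀⁱ)Δwⁱ⁺ + rⁱ + ρ(r_cⁱ + Δv̄_cⁱ − E_{Jᵢ}Δx) + ρ(Āⁱ)ᵀ(r_pⁱ + Δv̄ⁱ) = 0, that Δx⁺ satisfies Σᵢ E_{Jᵢ}ᵀ[v_cⁱ + ρ(Δwⁱ⁺ − E_{Jᵢ}Δx⁺ + r_cⁱ + Δv̄_cⁱ)] = 0, and define Δv̄ⁱ⁺ = Δv̄ⁱ + ĀⁱΔwⁱ⁺ + r_pⁱ, Δv̄_cⁱ⁺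 = Δv̄_cⁱ + Δwⁱ⁺ − E_{Jᵢ}Δx⁺ + r_cⁱ, Δvⁱ⁺ = ρΔv̄ⁱ⁺, Δv_cⁱ⁺ = ρΔv̄_cⁱ⁺. Then the residual vector r̂ of the linearized KKT system, whose blocks are (HⁱΔwⁱ⁺ + rⁱ + (Āⁱ)ᵀΔvⁱ⁺ + Δv_cⁱ⁺)ᵢ₌₁..N, Σᵢ(−E_{Jᵢ}ᵀΔv_cⁱ⁺ − E_{Jᵢ}ᵀv_cⁱ), (ĀⁱΔwⁱ⁺ + r_pⁱ)ᵢ₌₁..N and (Δwⁱ⁺ − E_{Jᵢ}Δx⁺ + r_cⁱ)ᵢ₌₁..N, satisfies ‖r̂‖² = Σᵢ₌₁ᴺ [ ρ²‖E_{Jᵢ}Δx − E_{Jᵢ}Δx⁺‖² + ‖Δwⁱ⁺ − E_{Jᵢ}Δx⁺ + r_cⁱ‖² + ‖ĀⁱΔwⁱ⁺ + r_pⁱ‖² ]. -/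
open Matrix

theorem stmt6 {N n : ℕ} (nn pp : Fin N → ℕ)
    (H : ∀ i, Matrix (Fin (nn i)) (Fin (nn i)) ℝ)
    (Abar : ∀ i, Matrix (Fin (pp i)) (Fin (nn i)) ℝ)
    (r rc : ∀ i, Fin (nn i) → ℝ) (rp : ∀ i, Fin (pp i) → ℝ)
    (E : ∀ i, Matrix (Fin (nn i)) (Fin n) ℝ)
    (vc : ∀ i, Fin (nn i) → ℝ)
    (ρ : ℝ) (hρ : 0 < ρ)
    (Δx : Fin n → ℝ) (Δvb : ∀ i, Fin (pp i) → ℝ) (Δvcb : ∀ i, Fin (nn i) → ℝ)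
    (Δw' : ∀ i, Fin (nn i) → ℝ)
    (hw : ∀ i, (H i + ρ • (1 : Matrix (Fin (nn i)) (Fin (nn i)) ℝ)
          + ρ • ((Abar i)ᵀ * Abar i)).mulVec (Δw' i)
        + r i + ρ • (rc i + Δvcb i - (E i).mulVec Δx)
        + ρ • (Abar i)ᵀ.mulVec (rp i + Δvb i) = 0)
    (Δx' : Fin n → ℝ)
    (hx : ∑ i, (E i)ᵀ.mulVec
        (vc i + ρ • (Δw' i - (E i).mulVec Δx' + rc i + Δvcb i)) = 0)
    (Δvb' : ∀ i, Fin (pp i) → ℝ) (Δvcb' : ∀ i, Fin (nn i) → ℝ)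
    (hvb : ∀ i, Δvb' i = Δvb i + (Abar i).mulVec (Δw' i) + rp i)
    (hvcb : ∀ i, Δvcb' i = Δvcb i + Δw' i - (E i).mulVec Δx' + rc i)
    (Δv' : ∀ i, Fin (pp i) → ℝ) (Δvc' : ∀ i, Fin (nn i) → ℝ)
    (hv : ∀ i, Δv' i = ρ • Δvb' i) (hvc : ∀ i, Δvc' i = ρ • Δvcb' i) :
    (∑ i, ((H i).mulVec (Δw' i) + r i + (Abar i)ᵀ.mulVec (Δv' i) + Δvc' i) ⬝ᵥ
          ((H i).mulVec (Δw' i) + r i + (Abar i)ᵀ.mulVec (Δv' i) + Δvc' i))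
      + (∑ i, (-(E i)ᵀ.mulVec (Δvc' i) - (E i)ᵀ.mulVec (vc i))) ⬝ᵥ
          (∑ i, (-(E i)ᵀ.mulVec (Δvc' i) - (E i)ᵀ.mulVec (vc i)))
      + (∑ i, ((Abar i).mulVec (Δw' i) + rp i) ⬝ᵥ ((Abar i).mulVec (Δw' i) + rp i))
      + (∑ i, (Δw' i - (E i).mulVec Δx' + rc i) ⬝ᵥ (Δw' i - (E i).mulVec Δx' + rc i))
    = ∑ i, (ρ ^ 2 * (((E i).mulVec Δx - (E i).mulVec Δx') ⬝ᵥ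
            ((E i).mulVec Δx - (E i).mulVec Δx'))
        + (Δw' i - (E i).mulVec Δx' + rc i) ⬝ᵥ (Δw' i - (E i).mulVec Δx' + rc i)
        + ((Abar i).mulVec (Δw' i) + rp i) ⬝ᵥ ((Abar i).mulVec (Δw' i) + rp i)) := by
  have h1 : ∀ i, (H i).mulVec (Δw' i) + r i + (Abar i)ᵀ.mulVec (Δv' i) + Δvc' i
      = ρ • ((E i).mulVec Δx - (E i).mulVec Δx') := by
    intro i
    have h := hw i
    rw [hv, hvc, hvb, hvcb]
    simp only [add_mulVec, smul_mulVec, one_mulVec, ← mulVec_mulVec, mulVec_add,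
      mulVec_smul] at h ⊢
    rw [← sub_eq_zero, ← h]
    module
  have h2 : ∑ i, (-(E i)ᵀ.mulVec (Δvc' i) - (E i)ᵀ.mulVec (vc i)) = 0 := by
    rw [← neg_eq_zero, ← hx, ← Finset.sum_neg_distrib]
    refine Finset.sum_congr rfl fun i _ => ?_
    rw [hvc, hvcb]
    simp only [mulVec_add, mulVec_sub, mulVec_smul]
    module
  rw [h2]
  simp only [h1, zero_dotProduct, Finset.sum_add_distrib, smul_dotProduct, dotProduct_smul,
    smul_eq_mul, ← mul_assoc, ← pow_two]
  ring
end

section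
/- Let H : ℝⁿ → ℝᵐ be Fréchet differentiable at z ∈ ℝⁿ with derivative H'(z), suppose H(z) ≠ 0 and let β ∈ (0,1). If p̃ ∈ ℝⁿ satisfies ‖H(z) + H'(z)p̃‖ < ‖H(z)‖, then there exists η_min ∈ [0,1) such that for every η ∈ [η_min, 1) there exists t ∈ (0,1] such that p = t·p̃ satisfies ‖H(z + p)‖ ≤ (1 − β(1 − η))‖H(z)‖. -/
theorem stmt8 {n m : ℕ}
    (H : EuclideanSpace ℝ (Fin n) → EuclideanSpace ℝ (Fin m))
    (z : EuclideanSpace ℝ (Fin n))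
    (H' : EuclideanSpace ℝ (Fin n) →L[ℝ] EuclideanSpace ℝ (Fin m))
    (hd : HasFDerivAt H H' z) (hz : H z ≠ 0)
    (β : ℝ) (hβ : β ∈ Set.Ioo (0 : ℝ) 1)
    (ptil : EuclideanSpace ℝ (Fin n)) (hp : ‖H z + H' ptil‖ < ‖H z‖) :
    ∃ ηmin ∈ Set.Ico (0 : ℝ) 1, ∀ η ∈ Set.Ico ηmin 1,
      ∃ t ∈ Set.Ioc (0 : ℝ) 1,
        ‖H (z + t • ptil)‖ ≤ (1 - β * (1 - η)) * ‖H z‖ := by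
  have hH : 0 < ‖H z‖ := norm_pos_iff.mpr hz
  obtain ⟨t, ht0, ht1, ht⟩ : ∃ t : ℝ, 0 < t ∧ t ≤ 1 ∧ ‖H (z + t • ptil)‖ < ‖H z‖ := by
    have hl : HasDerivAt (fun t : ℝ => H (z + t • ptil)) (H' ptil) 0 := hd.hasLineDerivAt ptil
    have hc : 0 < (‖H z‖ - ‖H z + H' ptil‖) / 2 := by linarith
    have h1 := (hasDerivAt_iff_isLittleO.mp hl).def hc
    obtain ⟨ε, hε, hb⟩ := Metric.eventually_nhds_iff.mp h1
    have ht0 : 0 < min (ε / 2) 1 := by positivity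
    refine ⟨min (ε / 2) 1, ht0, min_le_right _ _, ?_⟩
    have ht1 : min (ε / 2) 1 ≤ 1 := min_le_right _ _
    have hte : min (ε / 2) 1 < ε := lt_of_le_of_lt (min_le_left _ _) (by linarith)
    generalize min (ε / 2) 1 = t at *
    have h2 := hb (y := t) (by simpa [abs_of_pos ht0] using hte)
    simp only [sub_zero, zero_smul, add_zero, Real.norm_eq_abs, abs_of_pos ht0] at h2
    have e : H (z + t • ptil) = (H (z + t • ptil) - H z - t • H' ptil)
        + ((1 - t) • H z + t • (H z + H' ptil)) := by module
    have h3 := norm_add_le (H (z + t • ptil) - H z - t • H' ptil)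
      ((1 - t) • H z + t • (H z + H' ptil))
    rw [← e] at h3
    have h4 := norm_add_le ((1 - t) • H z) (t • (H z + H' ptil))
    rw [norm_smul, norm_smul, Real.norm_eq_abs, Real.norm_eq_abs, abs_of_pos ht0,
      abs_of_nonneg (by linarith : 0 ≤ 1 - t)] at h4
    nlinarith [mul_pos ht0 hc]
  refine ⟨‖H (z + t • ptil)‖ / ‖H z‖, ⟨by positivity, (div_lt_one hH).mpr ht⟩, ?_⟩
  rintro η ⟨h1, h2⟩
  refine ⟨t, ⟨ht0, ht1⟩, ?_⟩
  rw [div_le_iff₀ hH] at h1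
  refine h1.trans (mul_le_mul_of_nonneg_right ?_ hH.le)
  nlinarith [hβ.1, hβ.2]
end

section
/- Let m ≥ 1, let s, λ, Δs, Δλ ∈ ℝᵐ, μ > 0, and τ ∈ (0,1). Suppose that for every j = 1,…,m: λ_jΔs_j + s_jΔλ_j = −s_jλ_j + μ (the perturbed Newton complementarity relation) and s_jλ_j ≥ (τ/m)·sᵀλ (the centrality condition), and let M > 0 satisfy |Δs_jΔλ_j − (τ/m)·ΔsᵀΔλ| ≤ M for all j. Then for every α ∈ [0, min(1, (1−τ)μ/M)] and every j = 1,…,m: (s_j + αΔs_j)(λ_j + αΔλ_j) ≥ (τ/m)·(s + αΔs)ᵀ(λ + αΔλ). In particular, the expansion (s_j+αΔs_j)(λ_j+αΔλ_j) − (τ/m)(s+αΔs)ᵀ(λ+αΔλ) = (1−α)(s_jλ_j − (τ/m)sᵀλ) + α(1−τ)μ + α²(Δs_jΔλ_j − (τ/m)ΔsᵀΔλ) holds for all α. -/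
open Matrix

theorem stmt11 {m : ℕ} (hm : 1 ≤ m)
    (s lam Δs Δlam : Fin m → ℝ) (μ τ M : ℝ)
    (hμ : 0 < μ) (hτ : τ ∈ Set.Ioo (0 : ℝ) 1)
    (hnewton : ∀ j, lam j * Δs j + s j * Δlam j = -(s j * lam j) + μ)
    (hcent : ∀ j, s j * lam j ≥ (τ / (m : ℝ)) * (s ⬝ᵥ lam))
    (hM : 0 < M)
    (hMb : ∀ j, |Δs j * Δlam j - (τ / (m : ℝ)) * (Δs ⬝ᵥ Δlam)| ≤ M) :
    (∀ α ∈ Set.Icc (0 : ℝ) (min 1 ((1 - τ) * μ / M)), ∀ j,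
        (s j + α * Δs j) * (lam j + α * Δlam j)
          ≥ (τ / (m : ℝ)) * ((s + α • Δs) ⬝ᵥ (lam + α • Δlam))) ∧
      ∀ (α : ℝ) (j : Fin m),
        (s j + α * Δs j) * (lam j + α * Δlam j)
            - (τ / (m : ℝ)) * ((s + α • Δs) ⬝ᵥ (lam + α • Δlam))
          = (1 - α) * (s j * lam j - (τ / (m : ℝ)) * (s ⬝ᵥ lam))
            + α * (1 - τ) * μ
            + α ^ 2 * (Δs j * Δlam j - (τ / (m : ℝ)) * (Δs ⬝ᵥ Δlam)) := by
  have hm0 : (m : ℝ) ≠ 0 := by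
    have : m ≠ 0 := by omega
    exact_mod_cast this
  have key : ∀ α : ℝ, (s + α • Δs) ⬝ᵥ (lam + α • Δlam)
      = (1 - α) * (s ⬝ᵥ lam) + α * ((m : ℝ) * μ) + α ^ 2 * (Δs ⬝ᵥ Δlam) := by
    intro α
    have h1 : (m : ℝ) * μ = ∑ _j : Fin m, μ := by simp
    rw [h1]
    simp only [dotProduct, Finset.mul_sum, ← Finset.sum_add_distrib]
    refine Finset.sum_congr rfl fun j _ => ?_
    simp only [Pi.add_apply, Pi.smul_apply, smul_eq_mul]
    linear_combination α * hnewton j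
  have main : ∀ (α : ℝ) (j : Fin m),
        (s j + α * Δs j) * (lam j + α * Δlam j)
            - (τ / (m : ℝ)) * ((s + α • Δs) ⬝ᵥ (lam + α • Δlam))
          = (1 - α) * (s j * lam j - (τ / (m : ℝ)) * (s ⬝ᵥ lam))
            + α * (1 - τ) * μ
            + α ^ 2 * (Δs j * Δlam j - (τ / (m : ℝ)) * (Δs ⬝ᵥ Δlam)) := by
    intro α j
    rw [key]
    have h2 : τ / (m : ℝ) * m = τ := div_mul_cancel₀ _ hm0
    linear_combination α * hnewton j - α * μ * h2
  refine ⟨?_, main⟩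
  rintro α ⟨h0, h1⟩ j
  have ha := h1.trans (min_le_left _ _)
  have hb := (le_div_iff₀ hM).1 (h1.trans (min_le_right _ _))
  have hc := mul_nonneg (sub_nonneg.2 ha) (sub_nonneg.2 (hcent j))
  have hd := mul_le_mul_of_nonneg_left (abs_le.1 (hMb j)).1 (sq_nonneg α)
  have he := mul_le_mul_of_nonneg_left hb h0
  have hf := main α j
  have : α ^ 2 * -M = - (α * (α * M)) := by ring
  have : α * (1 - τ) * μ = α * ((1 - τ) * μ) := by ring
  linarith
end

section
/- Let m ≥ 1, s, λ, Δs, Δλ ∈ ℝᵐ, τ ≥ 0, μ ∈ ℝ and nonnegative reals r₀, r̂, K. Suppose: sᵀλ ≥ τ·r₀; sᵀΔλ + λᵀΔs = −sᵀλ + mμ; φ : [0,1] → ℝ is a nonnegative function with φ(α) ≤ (1−α)r₀ + α·r̂ + α²·K for all α ∈ [0,1]; c := mμ − τ·r̂ > 0; and M > 0 satisfies |ΔsᵀΔλ − τK| ≤ M. Then for every α ∈ [0, min(1, c/M)]: (s + αΔs)ᵀ(λ + αΔλ) ≥ τ·φ(α). -/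
open Matrix

theorem stmt12 {m : ℕ} (hm : 1 ≤ m)
    (s lam Δs Δlam : Fin m → ℝ)
    (τ μ r0 rhat K M : ℝ)
    (hτ : 0 ≤ τ) (hr0 : 0 ≤ r0) (hrhat : 0 ≤ rhat) (hK : 0 ≤ K)
    (h1 : s ⬝ᵥ lam ≥ τ * r0)
    (h2 : s ⬝ᵥ Δlam + lam ⬝ᵥ Δs = -(s ⬝ᵥ lam) + (m : ℝ) * μ)
    (φ : ℝ → ℝ)
    (hφ0 : ∀ α ∈ Set.Icc (0 : ℝ) 1, 0 ≤ φ α)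
    (hφ : ∀ α ∈ Set.Icc (0 : ℝ) 1, φ α ≤ (1 - α) * r0 + α * rhat + α ^ 2 * K)
    (hc : 0 < (m : ℝ) * μ - τ * rhat)
    (hM : 0 < M) (hMb : |Δs ⬝ᵥ Δlam - τ * K| ≤ M) :
    ∀ α ∈ Set.Icc (0 : ℝ) (min 1 (((m : ℝ) * μ - τ * rhat) / M)),
      (s + α • Δs) ⬝ᵥ (lam + α • Δlam) ≥ τ * φ α := by
  intro α hα
  obtain ⟨h0, hmin⟩ := hα
  have ha1 : α ≤ 1 := hmin.trans (min_le_left _ _)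
  have hac : α * M ≤ (m : ℝ) * μ - τ * rhat :=
    (le_div_iff₀ hM).mp (hmin.trans (min_le_right _ _))
  have hexp : (s + α • Δs) ⬝ᵥ (lam + α • Δlam)
      = s ⬝ᵥ lam + α * (s ⬝ᵥ Δlam + lam ⬝ᵥ Δs) + α ^ 2 * (Δs ⬝ᵥ Δlam) := by
    simp only [add_dotProduct, dotProduct_add, smul_dotProduct, dotProduct_smul, smul_eq_mul]
    rw [dotProduct_comm Δs lam]
    ring
  rw [hexp, h2]
  have hb := mul_le_mul_of_nonneg_left (hφ α ⟨h0, ha1⟩) hτ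
  have e1 : 0 ≤ (1 - α) * (s ⬝ᵥ lam - τ * r0) :=
    mul_nonneg (by linarith) (by linarith)
  have e2 : α * (-M) ≤ α * (Δs ⬝ᵥ Δlam - τ * K) :=
    mul_le_mul_of_nonneg_left (abs_le.mp hMb).1 h0
  have e3 : 0 ≤ α * ((m : ℝ) * μ - τ * rhat + α * (Δs ⬝ᵥ Δlam - τ * K)) :=
    mul_nonneg h0 (by linarith)
  linarith
end

section
/- Let ρ > 0, let F̃₁ ∈ ℝ^{n×n} with F̃₁ + ρAᵀA invertible, A ∈ ℝ^{q×n}, B ∈ ℝ^{q×d} with BᵀB invertible, c ∈ ℝ^q, f̃₁ ∈ ℝⁿ, f̃₂ ∈ ℝ^d, and set M₁ = (F̃₁ + ρAᵀA)⁻¹ and M₂ = (ρBᵀB)⁻¹. Define the one-step ADMM map sending (W, x, u) to (W⁺, x⁺, u⁺) by W⁺ = M₁(−f̃₁ + ρAᵀc − ρAᵀBx − ρAᵀu), x⁺ = M₂(−f̃₂ + ρBᵀc − ρBᵀAW⁺ − ρBᵀu), u⁺ = u + AW⁺ + Bx⁺ − c. Then (W, x, u) is a fixed point of this map, i.e. (W⁺,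 x⁺, u⁺) = (W, x, u), if and only if F̃₁W + ρAᵀu = −f̃₁, ρBᵀu = −f̃₂, and AW + Bx = c, i.e. if and only if (W, x, u) solves the KKT system A_KKT(W,x,u) = b_KKT with A_KKT = [[F̃₁, 0, ρAᵀ],[0, 0, ρBᵀ],[ρA, ρB, 0]] and b_KKT = (−f̃₁, −f̃₂, ρc). -/
open Matrix

theorem inv_mulVec_eq_iff_aux {m : ℕ} (M : Matrix (Fin m) (Fin m) ℝ) (hM : IsUnit M)
    (v w : Fin m → ℝ) : w = M⁻¹.mulVec v ↔ M.mulVec w = v := by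
  have hd : IsUnit M.det := (Matrix.isUnit_iff_isUnit_det M).1 hM
  constructor
  · rintro rfl
    rw [Matrix.mulVec_mulVec, Matrix.mul_nonsing_inv _ hd, Matrix.one_mulVec]
  · rintro rfl
    rw [Matrix.mulVec_mulVec, Matrix.nonsing_inv_mul _ hd, Matrix.one_mulVec]

theorem stmt13 {n d q : ℕ} (ρ : ℝ) (hρ : 0 < ρ)
    (F₁ : Matrix (Fin n) (Fin n) ℝ) (A : Matrix (Fin q) (Fin n) ℝ)
    (B : Matrix (Fin q) (Fin d) ℝ)
    (hF : IsUnit (F₁ + ρ • (Aᵀ * A))) (hB : IsUnit (Bᵀ * B))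
    (c : Fin q → ℝ) (f₁ : Fin n → ℝ) (f₂ : Fin d → ℝ)
    (M₁ : Matrix (Fin n) (Fin n) ℝ) (M₂ : Matrix (Fin d) (Fin d) ℝ)
    (hM₁ : M₁ = (F₁ + ρ • (Aᵀ * A))⁻¹) (hM₂ : M₂ = (ρ • (Bᵀ * B))⁻¹)
    (W W' : Fin n → ℝ) (x x' : Fin d → ℝ) (u u' : Fin q → ℝ)
    (hW' : W' = M₁.mulVec
      (-f₁ + ρ • Aᵀ.mulVec c - ρ • Aᵀ.mulVec (B.mulVec x) - ρ • Aᵀ.mulVec u))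
    (hx' : x' = M₂.mulVec
      (-f₂ + ρ • Bᵀ.mulVec c - ρ • Bᵀ.mulVec (A.mulVec W') - ρ • Bᵀ.mulVec u))
    (hu' : u' = u + A.mulVec W' + B.mulVec x' - c) :
    (W' = W ∧ x' = x ∧ u' = u) ↔
      (F₁.mulVec W + ρ • Aᵀ.mulVec u = -f₁ ∧
        ρ • Bᵀ.mulVec u = -f₂ ∧
        A.mulVec W + B.mulVec x = c) := by
  have hB' : IsUnit (ρ • (Bᵀ * B)) := by
    have := hB.smul (Units.mk0 ρ hρ.ne')
    simpa [Units.smul_def] using this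
  subst hM₁ hM₂
  have e1 : ∀ w, (F₁ + ρ • (Aᵀ * A)).mulVec w
      = F₁.mulVec w + ρ • Aᵀ.mulVec (A.mulVec w) := fun w => by
    rw [Matrix.add_mulVec, Matrix.smul_mulVec, Matrix.mulVec_mulVec]
  have e2 : ∀ w, (ρ • (Bᵀ * B)).mulVec w = ρ • Bᵀ.mulVec (B.mulVec w) := fun w => by
    rw [Matrix.smul_mulVec, Matrix.mulVec_mulVec]
  constructor
  · rintro ⟨rfl, rfl, rfl⟩
    have hc : A.mulVec W' + B.mulVec x' = c := by
      have h : u' + (A.mulVec W' + B.mulVec x' - c) = u' + 0 := by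
        rw [add_zero]; nth_rewrite 2 [hu']; abel
      exact sub_eq_zero.1 (add_left_cancel h)
    rw [inv_mulVec_eq_iff_aux _ hF, e1] at hW'
    rw [inv_mulVec_eq_iff_aux _ hB', e2] at hx'
    rw [← hc, Matrix.mulVec_add, smul_add] at hW' hx'
    refine ⟨?_, ?_, hc⟩
    · linear_combination hW'
    · linear_combination hx'
  · rintro ⟨h1, h2, hc⟩
    have hW : W' = W := by
      rw [hW']
      symm
      rw [inv_mulVec_eq_iff_aux _ hF, e1, ← hc, Matrix.mulVec_add, smul_add, ← h1]
      abel
    subst hW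
    have hx : x' = x := by
      rw [hx']
      symm
      rw [inv_mulVec_eq_iff_aux _ hB', e2, ← hc, Matrix.mulVec_add, smul_add, ← h2]
      abel
    subst hx
    refine ⟨rfl, rfl, ?_⟩
    rw [hu', ← hc]
    abel
end
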